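/- There do not exist real numbers p_i, q_i, r_i (1 ≤ i ≤ 4) with (r_1,r_2,r_3,r_4) ≠ (0,0,0,0) and (q_j, r_j) ≠ (0,0) for every j, such that, setting X_i(u) = p_i + q_i u + r_i u^2, the identity Σ_{j=1}^{4} X_j'(u_j) · Σ_{i≠j} X_i(u_i) = 0 holds for all (u_1,u_2,u_3,u_4) ∈ ℝ^4 with u_1+u_2+u_3+u_4 = 0. In other words, no separable minimal hypersurface in (ℝ^4, ‖·‖_{2m}) arises from genuinely quadratic data X_i. -/

import Mathlib

/-- The minimality expression `Σⱼ Xⱼ'(uⱼ) Σ_{i≠j} Xᵢ(uᵢ)` for quadratic `Xᵢ`. -/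
def minimalityForm (p q r u : Fin 4 → ℝ) : ℝ :=
  ∑ j, (q j + 2 * r j * u j)
    * ∑ i ∈ Finset.univ.erase j, (p i + q i * u i + r i * (u i) ^ 2)

lemma minimalityForm_eq (p q r u : Fin 4 → ℝ) :
    minimalityForm p q r u =
      (∑ j, (q j + 2 * r j * u j)) * (∑ i, (p i + q i * u i + r i * (u i) ^ 2))
        - ∑ j, (q j + 2 * r j * u j) * (p j + q j * u j + r j * (u j) ^ 2) := by
  simp only [minimalityForm, Finset.sum_erase_eq_sub (Finset.mem_univ _), mul_sub,
    Finset.sum_sub_distrib, Finset.sum_mul]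

lemma sum_smul_eq_zero {u : Fin 4 → ℝ} (hu : ∑ i, u i = 0) (t : ℝ) :
    ∑ i, (t • u) i = 0 := by
  simp [← Finset.mul_sum, hu]

/-- The cubic homogeneous part of the minimality expression vanishes on `Σ uᵢ = 0`. -/
lemma cubic_part_eq_zero {p q r : Fin 4 → ℝ}
    (h : ∀ u : Fin 4 → ℝ, ∑ i, u i = 0 → minimalityForm p q r u = 0)
    {u : Fin 4 → ℝ} (hu : ∑ i, u i = 0) :
    (∑ j, r j * u j) * (∑ i, r i * (u i) ^ 2) - ∑ j, r j ^ 2 * (u j) ^ 3 = 0 := by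
  have h₁ := h _ (sum_smul_eq_zero hu 1)
  have h₂ := h _ (sum_smul_eq_zero hu 2)
  have h₃ := h _ (sum_smul_eq_zero hu (-1))
  have h₄ := h _ (sum_smul_eq_zero hu (-2))
  simp only [minimalityForm_eq, Fin.sum_univ_four, Pi.smul_apply, smul_eq_mul] at *
  linear_combination (h₂ - 2 * h₁ - h₄ + 2 * h₃) / 24

/-- The quadratic homogeneous part of the minimality expression vanishes on `Σ uᵢ = 0`. -/
lemma quadratic_part_eq_zero {p q r : Fin 4 → ℝ}
    (h : ∀ u : Fin 4 → ℝ, ∑ i, u i = 0 → minimalityForm p q r u = 0)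
    {u : Fin 4 → ℝ} (hu : ∑ i, u i = 0) :
    (∑ j, q j) * (∑ i, r i * (u i) ^ 2) + 2 * (∑ j, r j * u j) * (∑ i, q i * u i)
      - 3 * ∑ j, q j * r j * (u j) ^ 2 = 0 := by
  have h₁ := h _ (sum_smul_eq_zero hu 1)
  have h₂ := h _ (sum_smul_eq_zero hu (-1))
  have h₀ := h _ (sum_smul_eq_zero hu 0)
  simp only [minimalityForm_eq, Fin.sum_univ_four, Pi.smul_apply, smul_eq_mul] at *
  linear_combination (h₁ + h₂ - 2 * h₀) / 2

/-- If the cubic part vanishes on `Σ uᵢ = 0`, at most one leading coefficient is nonzero. -/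
lemma mul_eq_zero_of_cubic_part {r : Fin 4 → ℝ}
    (h : ∀ u : Fin 4 → ℝ, ∑ i, u i = 0 →
      (∑ j, r j * u j) * (∑ i, r i * (u i) ^ 2) - ∑ j, r j ^ 2 * (u j) ^ 3 = 0) :
    r 0 * r 1 = 0 ∧ r 0 * r 2 = 0 ∧ r 0 * r 3 = 0 ∧
      r 1 * r 2 = 0 ∧ r 1 * r 3 = 0 ∧ r 2 * r 3 = 0 := by
  have e₁ := h ![1, 1, -1, -1] (by simp [Fin.sum_univ_four])
  have e₂ := h ![1, -1, 1, -1] (by simp [Fin.sum_univ_four])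
  have e₃ := h ![1, -1, -1, 1] (by simp [Fin.sum_univ_four])
  have e₄ := h ![1, 1, -2, 0] (by simp [Fin.sum_univ_four]; norm_num)
  simp [Fin.sum_univ_four] at e₁ e₂ e₃ e₄
  have a : r 0 * r 1 = r 2 * r 3 := by linear_combination e₁ / 2
  have b : r 0 * r 2 = r 1 * r 3 := by linear_combination e₂ / 2
  have c : r 0 * r 3 = r 1 * r 2 := by linear_combination e₃ / 2
  have s : r 0 * r 1 + r 0 * r 2 + r 1 * r 2 = 0 := by linear_combination e₄ / 2
  have sq_sum : (r 0 * r 1) ^ 2 + (r 0 * r 2) ^ 2 + (r 1 * r 2) ^ 2 = 0 := by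
    linear_combination (r 0 * r 1 + r 0 * r 2 + r 1 * r 2 - 2 * r 0 ^ 2) * s
      + 2 * r 0 * (r 0 * a + r 0 * b + (r 1 + r 2) * c)
  have h₀₁ : r 0 * r 1 = 0 := by nlinarith
  have h₀₂ : r 0 * r 2 = 0 := by nlinarith
  have h₁₂ : r 1 * r 2 = 0 := by nlinarith
  exact ⟨h₀₁, h₀₂, c.trans h₁₂, h₁₂, b.symm.trans h₀₂, a.symm.trans h₀₁⟩

/-- If exactly one leading coefficient is nonzero, the quadratic part forces all the other
linear coefficients to vanish. -/
lemma linear_coeff_eq_zero {q r : Fin 4 → ℝ} {k : Fin 4} (hk : r k ≠ 0)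
    (hz : ∀ j, j ≠ k → r j = 0)
    (h : ∀ u : Fin 4 → ℝ, ∑ i, u i = 0 →
      (∑ j, q j) * (∑ i, r i * (u i) ^ 2) + 2 * (∑ j, r j * u j) * (∑ i, q i * u i)
        - 3 * ∑ j, q j * r j * (u j) ^ 2 = 0) {l : Fin 4} (hl : l ≠ k) : q l = 0 := by
  have key : ∀ j, j ≠ k → (∑ i, q i) - q k = 2 * q j := by
    intro j hj
    have e := h (Pi.single k 1 - Pi.single j 1) (by simp)
    have hs : ∀ f : Fin 4 → ℝ, (∀ i, i ≠ k → f i = 0) → ∑ i, f i = f k :=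
      fun f hf => Finset.sum_eq_single k (fun i _ hi => hf i hi) (by simp)
    rw [hs (fun i => r i * _) fun i hi => by simp [hz i hi],
      hs (fun i => r i * _) fun i hi => by simp [hz i hi],
      hs (fun i => q i * r i * _) fun i hi => by simp [hz i hi]] at e
    simp [hj.symm, mul_sub, Finset.sum_sub_distrib, Pi.single_apply] at e
    apply mul_left_cancel₀ hk
    linear_combination e
  have hsum : ∑ i ∈ Finset.univ.erase k, 2 * q i = 3 * ((∑ i, q i) - q k) := by
    rw [Finset.sum_congr rfl fun i hi => (key i (Finset.ne_of_mem_erase hi)).symm]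
    simp [mul_sub]
  rw [← Finset.mul_sum, Finset.sum_erase_eq_sub (Finset.mem_univ k)] at hsum
  linarith [key l hl]


/-- no separable minimal hypersurface in `(ℝ⁴, ‖·‖_{2m})` arises
from genuinely quadratic data `Xᵢ(u) = pᵢ + qᵢ u + rᵢ u²`: there are no reals
`pᵢ, qᵢ, rᵢ` with `(r₁,r₂,r₃,r₄) ≠ 0` and `(qⱼ,rⱼ) ≠ (0,0)` for all `j` such that
`Σⱼ Xⱼ'(uⱼ) Σ_{i≠j} Xᵢ(uᵢ) = 0` whenever `u₁+u₂+u₃+u₄ = 0`. -/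
theorem no_quadratic_separable_minimal (p q r : Fin 4 → ℝ)
    (hr : r ≠ 0)
    (hqr : ∀ j, ¬(q j = 0 ∧ r j = 0))
    (hmin : ∀ u : Fin 4 → ℝ, (∑ i, u i) = 0 →
      ∑ j, (q j + 2 * r j * u j)
        * ∑ i ∈ Finset.univ.erase j, (p i + q i * u i + r i * (u i) ^ 2) = 0) :
    False := by
  have h : ∀ u : Fin 4 → ℝ, ∑ i, u i = 0 → minimalityForm p q r u = 0 := hmin
  obtain ⟨h₀₁, h₀₂, h₀₃, h₁₂, h₁₃, h₂₃⟩ :=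
    mul_eq_zero_of_cubic_part fun u hu => cubic_part_eq_zero h hu
  obtain ⟨k, hk⟩ := Function.ne_iff.mp hr
  have hz : ∀ j, j ≠ k → r j = 0 := by
    intro j hj
    fin_cases k <;> fin_cases j <;> simp_all
  obtain ⟨l, hl⟩ := exists_ne k
  exact hqr l ⟨linear_coeff_eq_zero hk hz (fun u hu => quadratic_part_eq_zero h hu) hl, hz l hl⟩
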